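/- Let E be a finite directed graph with nonempty vertex set such that every vertex receives at least one edge (E is source-free) and such that no two distinct cycles of E have a common vertex (any two cycles sharing a vertex have the same set of edges). Then the graph monoid M_E satisfies: for all positive integers m and n, m·[Σ_{v ∈ E⁰} v] = n·[Σ_{v ∈ E⁰} v] in M_E implies m = n. -/

import Mathlib

open Finset

/-- The defining relations of the graph monoid of a finite graph with edge set `Ed`, source
map `s` and range map `r`: for each regular vertex `v` (one emitting at least one edge),
`v = ∑_{e ∈ s⁻¹(v)} r(e)` in the free commutative monoid on the vertices. -/
def graphRel {V Ed : Type} [Fintype Ed] [DecidableEq V] (s r : Ed → V) :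
    (V →₀ ℕ) → (V →₀ ℕ) → Prop := fun x y =>
  ∃ v : V, (∃ e, s e = v) ∧ x = Finsupp.single v 1 ∧
    y = ∑ e ∈ univ.filter (fun e => s e = v), Finsupp.single (r e) 1

/-- The congruence on the free commutative monoid on the vertices generated by the graph
relations; the graph monoid `M_E` is its quotient `(graphCon s r).Quotient`. -/
noncomputable def graphCon {V Ed : Type} [Fintype Ed] [DecidableEq V] (s r : Ed → V) :
    AddCon (V →₀ ℕ) := addConGen (graphRel s r)

/-- A cycle in a graph with edge set `Ed`, source map `s` and range map `r`: a cyclic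
sequence of edges `c_0, …, c_n` with `r(c_i) = s(c_{i+1})` (indices mod `n + 1`) which
does not revisit any vertex. -/
def IsCycle {V Ed : Type} (s r : Ed → V) {n : ℕ} (c : Fin (n + 1) → Ed) : Prop :=
  (∀ i, r (c i) = s (c (i + 1))) ∧ Function.Injective (fun i => s (c i))

/-- If the range of an edge `e` reaches a vertex `v`, then some walk starting with `e`
ends at `v`. -/
theorem exists_walk_of_reflTransGen {V Ed : Type} (s r : Ed → V) (e : Ed) {v : V}
    (h : Relation.ReflTransGen (fun a b => ∃ f, s f = a ∧ r f = b) (r e) v) :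
    ∃ (n : ℕ) (w : ℕ → Ed), w 0 = e ∧ (∀ i < n, r (w i) = s (w (i + 1))) ∧ r (w n) = v := by
  induction h with
  | refl => exact ⟨0, fun _ => e, rfl, by simp, rfl⟩
  | tail _ hbc ih =>
    obtain ⟨n, w, h0, hw, hn⟩ := ih
    obtain ⟨f, hf, rfl⟩ := hbc
    refine ⟨n + 1, Function.update w (n + 1) f, ?_, fun i hi => ?_, by simp⟩
    · rw [Function.update_of_ne (by omega), h0]
    · rw [Function.update_of_ne (by omega)]
      rcases Nat.lt_succ_iff_lt_or_eq.mp hi with hi | rfl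
      · rw [Function.update_of_ne (by omega), hw i hi]
      · rw [Function.update_self, hn, hf]

/-- An edge whose range reaches its source is the first edge of a cycle. -/
theorem exists_isCycle_of_reflTransGen {V Ed : Type} (s r : Ed → V) (e : Ed)
    (h : Relation.ReflTransGen (fun a b => ∃ f, s f = a ∧ r f = b) (r e) (s e)) :
    ∃ (n : ℕ) (c : Fin (n + 1) → Ed), IsCycle s r c ∧ c 0 = e := by
  classical
  have hex := exists_walk_of_reflTransGen s r e h
  obtain ⟨w, h0, hw, hn⟩ := Nat.find_spec hex
  have hmin := fun {k : ℕ} => Nat.find_min (m := k) hex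
  generalize Nat.find hex = n at w h0 hw hn hmin
  have key : ∀ i j, i < j → j ≤ n → s (w i) ≠ s (w j) := by
    intro i j hij hj hs
    rcases Nat.eq_zero_or_pos i with rfl | hi
    · refine hmin (k := j - 1) (by omega) ⟨w, h0, fun k hk => hw k (by omega), ?_⟩
      rw [hw (j - 1) (by omega), Nat.sub_add_cancel (by omega), ← hs, h0]
    · refine hmin (k := n - (j - i)) (by omega)
        ⟨fun k => if k < i then w k else w (k + (j - i)), ?_, fun k hk => ?_, ?_⟩
      · simp [hi, h0]
      · rcases lt_trichotomy (k + 1) i with hki | hki | hki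
        · simp only [hki, show k < i by omega, if_true]
          exact hw k (by omega)
        · simp only [show k < i by omega, show ¬ k + 1 < i by omega, if_true, if_false]
          rw [hw k (by omega), show k + 1 + (j - i) = j by omega, hki, hs]
        · simp only [show ¬ k < i by omega, show ¬ k + 1 < i by omega, if_false]
          rw [hw _ (by omega), show k + (j - i) + 1 = k + 1 + (j - i) by omega]
      · simp only [show ¬ n - (j - i) < i by omega, if_false]
        rw [show n - (j - i) + (j - i) = n by omega, hn]
  refine ⟨n, fun i => w i, ⟨fun i => ?_, fun i j hij => ?_⟩, by simp [h0]⟩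
  · beta_reduce
    rw [Fin.val_add_one]
    split_ifs with hi
    · rw [hi, Fin.val_last, hn, h0]
    · exact hw _ (Fin.val_lt_last hi)
  · rcases lt_trichotomy i j with hlt | heq | hlt
    · exact absurd hij (key _ _ hlt (by omega))
    · exact heq
    · exact absurd hij.symm (key _ _ hlt (by omega))

/-- A finite nonempty type with a reflexive transitive relation has a minimal element: one
below which everything is equivalent to it. -/
theorem exists_forall_rel_symm {V : Type} [Finite V] [Nonempty V] (R : V → V → Prop)
    [IsPreorder V R] : ∃ v, ∀ u, R u v → R v u := by
  obtain ⟨v, hv⟩ := Finite.exists_min (fun v => {u | R u v}.ncard)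
  refine ⟨v, fun u huv => ?_⟩
  have heq : {x | R x u} = {x | R x v} :=
    Set.eq_of_subset_of_ncard_le (fun x hx => _root_.trans hx huv) (hv u) (Set.toFinite _)
  exact heq.symm.subset (refl v)

/-- An additive functional that is invariant under the graph relations is constant on the
classes of the graph congruence. -/
theorem linearCombination_eq_of_graphCon {V Ed : Type} [Fintype Ed] [DecidableEq V]
    {s r : Ed → V} {φ : V → ℕ}
    (hφ : ∀ v, (∃ e, s e = v) → φ v = ∑ e ∈ univ.filter (fun e => s e = v), φ (r e))
    {x y : V →₀ ℕ} (h : graphCon s r x y) :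
    Finsupp.linearCombination ℕ φ x = Finsupp.linearCombination ℕ φ y := by
  have hle : graphCon s r ≤ AddCon.ker (Finsupp.linearCombination ℕ φ).toAddMonoidHom := by
    refine AddCon.addConGen_le.mpr ?_
    rintro x y ⟨v, hv, rfl, rfl⟩
    simpa [AddCon.ker_rel] using hφ v hv
  exact hle h

/-- Let `E` be a finite graph with nonempty vertex set such that every vertex receives at
least one edge (`E` is source-free) and such that no two distinct cycles of `E` have a
common vertex (any two cycles sharing a vertex have the same set of edges).  Then the
graph monoid `M_E` satisfies: for all positive integers `m` and `n`,
`m·[Σ_{v ∈ E⁰} v] = n·[Σ_{v ∈ E⁰} v]` in `M_E` implies `m = n`. -/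
theorem stmt10 {V Ed : Type} [Fintype V] [Fintype Ed] [DecidableEq V] [Nonempty V]
    (s r : Ed → V)
    (hsf : ∀ v : V, ∃ e, r e = v)
    (hdisj : ∀ (n m : ℕ) (c : Fin (n + 1) → Ed) (d : Fin (m + 1) → Ed),
      IsCycle s r c → IsCycle s r d → (∃ i j, s (c i) = s (d j)) →
        Set.range c = Set.range d) :
    ∀ m n : ℕ, 0 < m → 0 < n →
      m • (graphCon s r).mk' (∑ v : V, Finsupp.single v 1) =
        n • (graphCon s r).mk' (∑ v : V, Finsupp.single v 1) → m = n := by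
  classical
  intro m n _ _ hmn
  obtain ⟨v₀, hv₀⟩ := exists_forall_rel_symm
    (Relation.ReflTransGen (fun a b => ∃ f, s f = a ∧ r f = b))
  set R := Relation.ReflTransGen (fun a b => ∃ f, s f = a ∧ r f = b) with hR
  have hstep : ∀ e, R (s e) (r e) := fun e => Relation.ReflTransGen.single ⟨e, rfl, rfl⟩
  let φ : V → ℕ := fun v => if R v v₀ then 1 else 0
  have hφ : ∀ v, (∃ e, s e = v) →
      φ v = ∑ e ∈ univ.filter (fun e => s e = v), φ (r e) := by
    intro v _
    by_cases hv : R v v₀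
    · have hout : ∃ e, s e = v ∧ R (r e) v₀ := by
        obtain ⟨e, he⟩ := hsf v
        have hev : R v (s e) := hv.trans (hv₀ _ ((hstep e).trans (he ▸ hv)))
        rcases hev.cases_head with h | ⟨_, ⟨f, hf, rfl⟩, hfe⟩
        · exact ⟨e, h.symm, he ▸ hv⟩
        · exact ⟨f, hf, hfe.trans ((hstep e).trans (he ▸ hv))⟩
      obtain ⟨e, hes, her⟩ := hout
      have huniq : ∀ f, s f = v → R (r f) v₀ → f = e := by
        intro f hfs hfr
        obtain ⟨k, c, hc, hc0⟩ := exists_isCycle_of_reflTransGen s r e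
          (hes ▸ her.trans (hv₀ _ hv))
        obtain ⟨l, d, hd, hd0⟩ := exists_isCycle_of_reflTransGen s r f
          (hfs ▸ hfr.trans (hv₀ _ hv))
        have hrange := hdisj k l c d hc hd ⟨0, 0, by rw [hc0, hd0, hes, hfs]⟩
        obtain ⟨j, hj⟩ : f ∈ Set.range c := hrange ▸ ⟨0, hd0⟩
        have hj0 : j = 0 := hc.2 (by simp only [hj, hc0, hes, hfs])
        rw [← hj, hj0, hc0]
      rw [Finset.sum_eq_single_of_mem e (by simp [hes])]
      · simp [φ, hv, her]
      · intro f hf hne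
        exact if_neg fun hfr => hne (huniq f (by simpa using hf) hfr)
    · rw [Finset.sum_eq_zero]
      · simp [φ, hv]
      · intro e he
        have hes : s e = v := by simpa using he
        exact if_neg fun her => hv (hes ▸ (hstep e).trans her)
  rw [← map_nsmul, ← map_nsmul] at hmn
  have h := linearCombination_eq_of_graphCon hφ ((graphCon s r).eq.mp hmn)
  simp only [map_nsmul, map_sum, Finsupp.linearCombination_single, smul_eq_mul] at h
  refine Nat.eq_of_mul_eq_mul_right ?_ h
  exact Finset.sum_pos' (fun _ _ => Nat.zero_le _)
    ⟨v₀, mem_univ _, by simp [φ, hR, Relation.ReflTransGen.refl]⟩
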